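/- arXiv:2410.11098 — 3 statements merged into one kernel-verified Lean document; each statement's English description precedes it below -/
import Mathlib

section
/- Let A and A' be periodic abelian groups. Then the endomorphism rings End A and End A' are elementarily equivalent (in the first-order language of rings) if and only if for every prime p the endomorphism rings End A_p and End A_p' of the corresponding p-components are elementarily equivalent. -/
open FirstOrder

/-- The `p`-component of an abelian group: the subgroup of elements of `p`-power order. -/
def pComponent (A : Type*) [AddCommGroup A] (p : ℕ) : AddSubgroup A where
  carrier := {a | ∃ n : ℕ, p ^ n • a = 0}
  zero_mem' := ⟨0, smul_zero _⟩
  add_mem' := by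
    rintro a b ⟨n, hn⟩ ⟨m, hm⟩
    refine ⟨n + m, ?_⟩
    have ha : p ^ (n + m) • a = 0 := by
      rw [pow_add, mul_comm, mul_smul, hn, smul_zero]
    have hb : p ^ (n + m) • b = 0 := by
      rw [pow_add, mul_smul, hm, smul_zero]
    rw [smul_add, ha, hb, add_zero]
  neg_mem' := by
    rintro a ⟨n, hn⟩
    exact ⟨n, by rw [smul_neg, hn, neg_zero]⟩

attribute [local instance] FirstOrder.Ring.compatibleRingOfRing

section ModelTheory

open Language

/-- A ring homomorphism as a homomorphism of structures in the language of rings. -/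
def RingHom.toLanguageHom {R S : Type*} [Ring R] [Ring S] (f : R →+* S) :
    Language.ring.Hom R S where
  toFun := f
  map_fun' := fun {n} g => by cases g <;> simp
  map_rel' := fun {n} r => by cases r

theorem RingHom.realize_term {R S : Type*} [Ring R] [Ring S] (f : R →+* S) {α : Type*}
    (t : Language.ring.Term α) (v : α → R) :
    t.realize (f ∘ v) = f (t.realize v) :=
  HomClass.realize_term (RingHom.toLanguageHom f)

theorem FirstOrder.Language.BoundedFormula.exists_realize_snoc_iff {L : Language}
    {α β : Type} {n : ℕ} [Finite β] (Δ : β → L.BoundedFormula α (n + 1))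
    {M M' : Type*} [L.Structure M] [L.Structure M']
    {v : α → M} {xs : Fin n → M} {v' : α → M'} {xs' : Fin n → M'}
    (h : ∀ s : Set β,
      (∃' BoundedFormula.iInf fun d => open Classical in
        if d ∈ s then Δ d else ∼(Δ d)).Realize v xs →
      (∃' BoundedFormula.iInf fun d => open Classical in
        if d ∈ s then Δ d else ∼(Δ d)).Realize v' xs')
    (b : M) :
    ∃ b' : M', ∀ d, (Δ d).Realize v (Fin.snoc xs b) ↔ (Δ d).Realize v' (Fin.snoc xs' b') := by
  classical
  obtain ⟨b', hb'⟩ := BoundedFormula.realize_ex.1 <|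
    h {d | (Δ d).Realize v (Fin.snoc xs b)} <| BoundedFormula.realize_ex.2 ⟨b, by
      rw [BoundedFormula.realize_iInf]
      intro d
      by_cases hd : (Δ d).Realize v (Fin.snoc xs b) <;> simp [hd]⟩
  refine ⟨b', fun d => ?_⟩
  rw [BoundedFormula.realize_iInf] at hb'
  have := hb' d
  by_cases hd : (Δ d).Realize v (Fin.snoc xs b) <;> simpa [hd] using this

/-- A Feferman–Vaught style statement: the truth of a formula in a direct product only depends on
the truth of finitely many formulas in the factors. -/
theorem exists_formulas_determining_product {ι R R' : Type*} {S S' : ι → Type*}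
    [Ring R] [Ring R'] [∀ i, Ring (S i)] [∀ i, Ring (S' i)]
    (π : ∀ i, R →+* S i) (π' : ∀ i, R' →+* S' i)
    (hπ : Function.Bijective fun r i => π i r) (hπ' : Function.Bijective fun r i => π' i r)
    {α : Type} {n : ℕ} (φ : Language.ring.BoundedFormula α n) :
    ∃ (β : Type) (_ : Finite β) (Δ : β → Language.ring.BoundedFormula α n),
      ∀ (v : α → R) (xs : Fin n → R) (v' : α → R') (xs' : Fin n → R'),
        (∀ i d, (Δ d).Realize (π i ∘ v) (π i ∘ xs) ↔ (Δ d).Realize (π' i ∘ v') (π' i ∘ xs')) →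
        (φ.Realize v xs ↔ φ.Realize v' xs') := by
  induction φ with
  | falsum => exact ⟨Empty, inferInstance, Empty.elim, fun _ _ _ _ _ => Iff.rfl⟩
  | equal t₁ t₂ =>
    refine ⟨Unit, inferInstance, fun _ => .equal t₁ t₂, fun v xs v' xs' h => ?_⟩
    simp only [BoundedFormula.Realize, ← Sum.comp_elim, RingHom.realize_term] at h ⊢
    rw [← hπ.1.eq_iff, ← hπ'.1.eq_iff, funext_iff, funext_iff]
    exact forall_congr' fun i => h i ()
  | rel r => cases r
  | imp φ ψ ih₁ ih₂ =>
    obtain ⟨β₁, _, Δ₁, h₁⟩ := ih₁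
    obtain ⟨β₂, _, Δ₂, h₂⟩ := ih₂
    refine ⟨β₁ ⊕ β₂, inferInstance, Sum.elim Δ₁ Δ₂, fun v xs v' xs' h => ?_⟩
    exact imp_congr (h₁ _ _ _ _ fun i d => h i (.inl d)) (h₂ _ _ _ _ fun i d => h i (.inr d))
  | all φ ih =>
    obtain ⟨β, _, Δ, hΔ⟩ := ih
    refine ⟨Set β, inferInstance, fun s => ∃' BoundedFormula.iInf fun d => open Classical in
      if d ∈ s then Δ d else ∼(Δ d), fun v xs v' xs' h => ?_⟩
    rw [BoundedFormula.realize_all, BoundedFormula.realize_all]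
    constructor
    · intro H r'
      choose b hb using fun i => BoundedFormula.exists_realize_snoc_iff Δ
        (fun s => (h i s).2) (π' i r')
      obtain ⟨r, hr⟩ := hπ.2 b
      refine (hΔ _ _ _ _ fun i d => ?_).1 (H r)
      rw [Fin.comp_snoc, Fin.comp_snoc, hb i d, ← hr]
    · intro H r
      choose b hb using fun i => BoundedFormula.exists_realize_snoc_iff Δ
        (fun s => (h i s).1) (π i r)
      obtain ⟨r', hr'⟩ := hπ'.2 b
      refine (hΔ _ _ _ _ fun i d => ?_).2 (H r')
      rw [Fin.comp_snoc, Fin.comp_snoc, hb i d, ← hr']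

/-- Direct products of elementarily equivalent rings are elementarily equivalent. -/
theorem elementarilyEquivalent_of_bijective_pi {ι R R' : Type*} {S S' : ι → Type*}
    [Ring R] [Ring R'] [∀ i, Ring (S i)] [∀ i, Ring (S' i)]
    (π : ∀ i, R →+* S i) (π' : ∀ i, R' →+* S' i)
    (hπ : Function.Bijective fun r i => π i r) (hπ' : Function.Bijective fun r i => π' i r)
    (h : ∀ i, Language.ring.ElementarilyEquivalent (S i) (S' i)) :
    Language.ring.ElementarilyEquivalent R R' := by
  rw [elementarilyEquivalent_iff]
  intro φ
  obtain ⟨β, _, Δ, hΔ⟩ := exists_formulas_determining_product π π' hπ hπ' φ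
  refine hΔ _ _ _ _ fun i d => ?_
  have := elementarilyEquivalent_iff.1 (h i) (Δ d)
  simpa only [Sentence.Realize, Formula.Realize, Subsingleton.elim _ (default : Fin 0 → _),
    Subsingleton.elim _ (default : Empty → _)] using this

/-- The term `1 + ⋯ + 1` of the language of rings representing a natural number. -/
def natCastTerm {α : Type*} : ℕ → Language.ring.Term α
  | 0 => 0
  | m + 1 => natCastTerm m + 1

theorem realize_natCastTerm {R : Type*} [Ring R] {α : Type*} (m : ℕ) (v : α → R) :
    (natCastTerm m).realize v = (m : R) := by
  induction m with
  | zero => simp [natCastTerm]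
  | succ m ih => simp [natCastTerm, ih]

/-- Translation of formulas about a quotient of a ring into formulas about the ring, where the
kernel of the quotient map consists of those `x` such that `x = m * y * x` for some `y`. -/
def quotientFormula (m : ℕ) {α : Type*} :
    {n : ℕ} → Language.ring.BoundedFormula α n → Language.ring.BoundedFormula α n
  | _, .falsum => .falsum
  | n, .equal t₁ t₂ =>
    let t := (t₁ + -t₂).relabel (Sum.map id Fin.castSucc)
    ∃' .equal t (natCastTerm m * .var (.inr (Fin.last n)) * t)
  | _, .rel r ts => .rel r ts
  | _, .imp φ ψ => .imp (quotientFormula m φ) (quotientFormula m ψ)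
  | _, .all φ => .all (quotientFormula m φ)

theorem realize_quotientFormula {m : ℕ} {R S : Type*} [Ring R] [Ring S] {π : R →+* S}
    (hπ : Function.Surjective π) (hker : ∀ x, π x = 0 ↔ ∃ y, x = m * y * x)
    {α : Type*} {n : ℕ} (φ : Language.ring.BoundedFormula α n) (v : α → R) (xs : Fin n → R) :
    (quotientFormula m φ).Realize v xs ↔ φ.Realize (π ∘ v) (π ∘ xs) := by
  induction φ with
  | falsum => exact Iff.rfl
  | equal t₁ t₂ =>
    have hcomp (y : R) :
        Sum.elim v (Fin.snoc xs y : Fin _ → R) ∘ Sum.map id Fin.castSucc = Sum.elim v xs := by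
      ext (i | i) <;> simp
    simp only [quotientFormula, BoundedFormula.realize_ex, BoundedFormula.Realize,
      Term.realize_relabel, hcomp, Ring.realize_add, Ring.realize_neg, Ring.realize_mul,
      realize_natCastTerm, Term.realize_var, Sum.elim_inr, Fin.snoc_last, ← Sum.comp_elim,
      RingHom.realize_term, ← hker, map_add, map_neg]
    rw [← sub_eq_add_neg, sub_eq_zero]
  | rel r => cases r
  | imp φ ψ ih₁ ih₂ => exact imp_congr (ih₁ xs) (ih₂ xs)
  | all φ ih =>
    rw [quotientFormula, BoundedFormula.realize_all, BoundedFormula.realize_all,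
      hπ.forall]
    refine forall_congr' fun r => ?_
    rw [ih, Fin.comp_snoc]

/-- Quotients of elementarily equivalent rings by uniformly definable kernels are elementarily
equivalent. -/
theorem elementarilyEquivalent_of_ker {m : ℕ} {R R' S S' : Type*}
    [Ring R] [Ring R'] [Ring S] [Ring S'] {π : R →+* S} {π' : R' →+* S'}
    (hπ : Function.Surjective π) (hπ' : Function.Surjective π')
    (hker : ∀ x, π x = 0 ↔ ∃ y, x = m * y * x) (hker' : ∀ x, π' x = 0 ↔ ∃ y, x = m * y * x)
    (h : Language.ring.ElementarilyEquivalent R R') :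
    Language.ring.ElementarilyEquivalent S S' := by
  rw [elementarilyEquivalent_iff] at h ⊢
  intro φ
  have H := h (quotientFormula m φ)
  simp only [Sentence.Realize, Formula.Realize] at H ⊢
  rw [realize_quotientFormula hπ hker, realize_quotientFormula hπ' hker'] at H
  simpa only [Subsingleton.elim _ (default : Fin 0 → _),
    Subsingleton.elim _ (default : Empty → _)] using H

end ModelTheory

section Components

theorem eq_zero_of_coprime_nsmul_eq_zero {A : Type*} [AddCommGroup A] {m n : ℕ}
    (h : m.Coprime n) {a : A} (hm : m • a = 0) (hn : n • a = 0) : a = 0 := by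
  have := Nat.dvd_gcd (addOrderOf_dvd_of_nsmul_eq_zero hm) (addOrderOf_dvd_of_nsmul_eq_zero hn)
  rwa [h, Nat.dvd_one, AddMonoid.addOrderOf_eq_one_iff] at this

/-- The subgroup of elements killed by an integer coprime to `p`. -/
def coprimeTorsion (A : Type*) [AddCommGroup A] (p : ℕ) : AddSubgroup A where
  carrier := {a | ∃ n : ℕ, p.Coprime n ∧ n • a = 0}
  zero_mem' := ⟨1, Nat.coprime_one_right p, smul_zero _⟩
  add_mem' := by
    rintro a b ⟨n, hpn, hn⟩ ⟨m, hpm, hm⟩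
    refine ⟨n * m, hpn.mul_right hpm, ?_⟩
    rw [smul_add, mul_smul, mul_smul, hm, smul_zero, add_zero, smul_comm, hn, smul_zero]
  neg_mem' := by
    rintro a ⟨n, hpn, hn⟩
    exact ⟨n, hpn, by rw [smul_neg, hn, neg_zero]⟩

variable {A : Type*} [AddCommGroup A]

theorem disjoint_pComponent_coprimeTorsion (p : ℕ) :
    Disjoint (pComponent A p) (coprimeTorsion A p) := by
  rw [AddSubgroup.disjoint_def]
  rintro a ⟨k, hk⟩ ⟨n, hpn, hn⟩
  exact eq_zero_of_coprime_nsmul_eq_zero (hpn.pow_left k) hk hn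

theorem iSupIndep_pComponent : iSupIndep fun p : Nat.Primes => pComponent A p := by
  intro p
  refine (disjoint_pComponent_coprimeTorsion (p : ℕ)).mono_right ?_
  refine iSup₂_le fun q hq => ?_
  rintro a ⟨k, hk⟩
  exact ⟨_, ((Nat.coprime_primes p.2 q.2).2 fun h => hq (Subtype.ext h.symm)).pow_right k, hk⟩

theorem mem_iSup_pComponent {n : ℕ} (hn : n ≠ 0) (a : A) (ha : n • a = 0) :
    a ∈ ⨆ p : Nat.Primes, pComponent A p := by
  induction n using Nat.recOnPosPrimePosCoprime generalizing a with
  | zero => exact absurd rfl hn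
  | one => simp_all
  | prime_pow p k hp hk =>
    exact AddSubgroup.mem_iSup_of_mem (⟨p, hp⟩ : Nat.Primes) ⟨k, ha⟩
  | coprime m n hm hn' h ih₁ ih₂ =>
    have hbez : a = m.gcdA n • m • a + m.gcdB n • n • a := by
      have := Nat.gcd_eq_gcd_ab m n
      rw [Nat.Coprime.gcd_eq_one h] at this
      rw [← natCast_zsmul a m, ← natCast_zsmul a n, ← mul_smul, ← mul_smul, ← add_smul,
        mul_comm _ (m : ℤ), mul_comm _ (n : ℤ), ← this]
      simp
    rw [hbez]
    refine add_mem (zsmul_mem (ih₂ (by omega) _ ?_) _) (zsmul_mem (ih₁ (by omega) _ ?_) _)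
    · rw [← mul_smul, mul_comm, ha]
    · rw [← mul_smul, ha]

theorem isInternal_pComponent (hA : IsAddTorsion A) :
    DirectSum.IsInternal fun p : Nat.Primes => pComponent A p := by
  refine ⟨iSupIndep_pComponent.dfinsuppSumAddHom_injective, fun a => ?_⟩
  have ha := mem_iSup_pComponent (hA a).addOrderOf_pos.ne' a (addOrderOf_nsmul_eq_zero a)
  have hle : ⨆ p : Nat.Primes, pComponent A p ≤
      (DirectSum.coeAddMonoidHom fun p : Nat.Primes => pComponent A p).range :=
    iSup_le fun p a ha => ⟨DirectSum.of (fun p : Nat.Primes => pComponent A p) p ⟨a, ha⟩,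
      DirectSum.coeAddMonoidHom_of _ p _⟩
  exact hle ha

/-- Restriction of endomorphisms to the `p`-component. -/
def pComponentRestrict (A : Type*) [AddCommGroup A] (p : ℕ) :
    AddMonoid.End A →+* AddMonoid.End (pComponent A p) where
  toFun f :=
    { toFun a := ⟨f (a : A), by
        obtain ⟨k, hk⟩ := a.2
        exact ⟨k, by rw [← map_nsmul, hk, map_zero]⟩⟩
      map_zero' := Subtype.ext (map_zero f)
      map_add' a b := Subtype.ext (map_add f (a : A) (b : A)) }
  map_one' := rfl
  map_mul' _ _ := rfl
  map_zero' := rfl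
  map_add' _ _ := rfl

theorem bijective_pComponentRestrict (hA : IsAddTorsion A) :
    Function.Bijective fun (f : AddMonoid.End A) (p : Nat.Primes) => pComponentRestrict A p f := by
  have hinternal := isInternal_pComponent hA
  let e : (DirectSum Nat.Primes fun p => pComponent A p) ≃+ A := AddEquiv.ofBijective _ hinternal
  have he (p : Nat.Primes) (a : pComponent A p) :
      e (DirectSum.of (fun p : Nat.Primes => pComponent A p) p a) = a :=
    DirectSum.coeAddMonoidHom_of (fun p : Nat.Primes => pComponent A p) p a
  constructor
  · intro f g hfg
    have hcomp : AddMonoidHom.comp (f : A →+ A) e.toAddMonoidHom =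
        AddMonoidHom.comp (g : A →+ A) e.toAddMonoidHom := by
      refine DirectSum.addHom_ext fun p a => ?_
      have := congrArg Subtype.val (DFunLike.congr_fun (congrFun hfg p) a)
      change f (e _) = g (e _)
      rw [he]
      exact this
    refine AddMonoidHom.ext fun a => ?_
    have : f (e (e.symm a)) = g (e (e.symm a)) := DFunLike.congr_fun hcomp (e.symm a)
    rwa [e.apply_symm_apply] at this
  · intro g
    refine ⟨(e.toAddMonoidHom.comp (DirectSum.map g)).comp e.symm.toAddMonoidHom, ?_⟩
    funext p
    refine AddMonoidHom.ext fun a => Subtype.ext ?_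
    change e (DirectSum.map g (e.symm a)) = g p a
    rw [← he p a, e.symm_apply_apply]
    exact (congrArg e (DirectSum.map_of (f := g) p a)).trans (he p _)

theorem exists_natCast_mul_eq_one {p q : ℕ} (h : p.Coprime q) :
    ∃ u : AddMonoid.End (pComponent A q), (p : AddMonoid.End (pComponent A q)) * u = 1 := by
  have hbij : Function.Bijective (nsmulAddMonoidHom p : pComponent A q →+ pComponent A q) := by
    constructor
    · rw [injective_iff_map_eq_zero]
      rintro ⟨a, k, hk⟩ ha
      exact Subtype.ext <| eq_zero_of_coprime_nsmul_eq_zero (h.pow_right k)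
        (congrArg Subtype.val ha) hk
    · intro a
      obtain ⟨k, hk⟩ := a.2
      have hk' : q ^ k • a = 0 := Subtype.ext hk
      refine ⟨p.gcdA (q ^ k) • a, ?_⟩
      have := Nat.gcd_eq_gcd_ab p (q ^ k)
      rw [Nat.Coprime.gcd_eq_one (h.pow_right k)] at this
      have h1 : a = ((1 : ℕ) : ℤ) • a := by simp
      rw [this, add_smul, mul_comm ((q ^ k : ℕ) : ℤ), mul_smul, mul_smul, natCast_zsmul,
        natCast_zsmul, hk', smul_zero, add_zero] at h1
      exact h1.symm
  let e := AddEquiv.ofBijective _ hbij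
  refine ⟨e.symm.toAddMonoidHom, ?_⟩
  refine AddMonoidHom.ext fun a => ?_
  exact e.apply_symm_apply a

theorem pComponentRestrict_surjective (hA : IsAddTorsion A) (p : Nat.Primes) :
    Function.Surjective (pComponentRestrict A p) := by
  classical
  intro g
  obtain ⟨f, hf⟩ := (bijective_pComponentRestrict hA).2 (Function.update 0 p g)
  exact ⟨f, by simpa using congrFun hf p⟩

theorem pComponentRestrict_eq_zero_iff (hA : IsAddTorsion A) (p : Nat.Primes)
    (x : AddMonoid.End A) : pComponentRestrict A p x = 0 ↔ ∃ y, x = (p : ℕ) * y * x := by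
  classical
  constructor
  · intro hx
    have hu (q : Nat.Primes) : ∃ u : AddMonoid.End (pComponent A q), q ≠ p →
        ((p : ℕ) : AddMonoid.End (pComponent A q)) * u = 1 := by
      by_cases hq : q = p
      · exact ⟨0, fun h => absurd hq h⟩
      · obtain ⟨u, hu⟩ := exists_natCast_mul_eq_one (A := A)
          ((Nat.coprime_primes p.2 q.2).2 fun h => hq (Subtype.ext h.symm))
        exact ⟨u, fun _ => hu⟩
    choose u hu using hu
    obtain ⟨y, hy⟩ := (bijective_pComponentRestrict hA).2 u
    refine ⟨y, (bijective_pComponentRestrict hA).1 (funext fun q => ?_)⟩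
    have hyq : pComponentRestrict A q y = u q := congrFun hy q
    simp only [map_mul, map_natCast, hyq]
    by_cases hq : q = p
    · subst hq
      simp [hx]
    · rw [hu q hq, one_mul]
  · rintro ⟨y, hy⟩
    have hpow (k : ℕ) : x = ((p : ℕ) : AddMonoid.End A) ^ k * (y ^ k * x) := by
      induction k with
      | zero => simp
      | succ k ih =>
        have hc : Commute (((p : ℕ) : AddMonoid.End A)) y := Nat.cast_commute _ _
        nth_rewrite 1 [hy, ih]
        rw [pow_succ', pow_succ']
        simp only [mul_assoc]
        rw [← mul_assoc y, ← (hc.pow_left k).eq, mul_assoc]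
    refine AddMonoidHom.ext fun a => Subtype.ext ?_
    obtain ⟨k, hk⟩ := a.2
    change x a = 0
    rw [hpow k, ← Nat.cast_pow, AddMonoid.End.coe_mul, Function.comp_apply,
      AddMonoid.End.natCast_apply, ← map_nsmul, hk, map_zero]

end Components

/-- For periodic abelian groups `A` and `A'`, the endomorphism rings
`End A` and `End A'` are elementarily equivalent in the first-order language of rings
if and only if for every prime `p` the endomorphism rings of the corresponding
`p`-components are elementarily equivalent. -/
theorem endRing_elementarilyEquivalent_iff_forall_prime
    (A : Type*) (A' : Type*) [AddCommGroup A] [AddCommGroup A']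
    (hA : AddMonoid.IsTorsion A) (hA' : AddMonoid.IsTorsion A') :
    Language.ring.ElementarilyEquivalent (AddMonoid.End A) (AddMonoid.End A') ↔
      ∀ p : ℕ, p.Prime →
        Language.ring.ElementarilyEquivalent
          (AddMonoid.End ↥(pComponent A p)) (AddMonoid.End ↥(pComponent A' p)) := by
  refine ⟨fun h p hp => ?_, fun h => ?_⟩
  · exact elementarilyEquivalent_of_ker (pComponentRestrict_surjective hA ⟨p, hp⟩)
      (pComponentRestrict_surjective hA' ⟨p, hp⟩) (pComponentRestrict_eq_zero_iff hA ⟨p, hp⟩)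
      (pComponentRestrict_eq_zero_iff hA' ⟨p, hp⟩) h
  · exact elementarilyEquivalent_of_bijective_pi _ _ (bijective_pComponentRestrict hA)
      (bijective_pComponentRestrict hA') fun p => h p p.2
end

section
/- Let A be a periodic abelian group. An element e of End A is a central idempotent if and only if there exists a set M of primes such that e is the projection of A onto the direct summand ⊕_{p∈M} A_p along ⊕_{p∉M} A_p. -/
theorem map_mem_pComponent {A B : Type*} [AddCommGroup A] [AddCommGroup B] (f : A →+ B) {p : ℕ}
    {a : A} (ha : a ∈ pComponent A p) : f a ∈ pComponent B p := by
  obtain ⟨n, hn⟩ := ha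
  exact ⟨n, by rw [← map_nsmul, hn, map_zero]⟩

/-- A torsion abelian group is generated by its primary components. -/
theorem iSup_pComponent_eq_top {A : Type*} [AddCommGroup A] (hA : IsAddTorsion A) :
    ⨆ p : Nat.Primes, pComponent A p = ⊤ := by
  have key : ∀ n : ℕ, 0 < n → ∀ a : A, n • a = 0 → a ∈ ⨆ p : Nat.Primes, pComponent A p := by
    intro n
    induction n using Nat.recOnPosPrimePosCoprime with
    | zero => intro h; omega
    | one =>
      intro _ a ha
      rw [one_nsmul] at ha
      exact ha ▸ zero_mem _
    | prime_pow p n hp _ =>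
      intro _ a ha
      exact le_iSup (fun p : Nat.Primes => pComponent A p) ⟨p, hp⟩ ⟨n, ha⟩
    | coprime m k hm hk hmk ihm ihk =>
      intro _ a ha
      have hz : ((m : ℤ) * k) • a = 0 := by
        rw [← Nat.cast_mul, natCast_zsmul, ha]
      obtain ⟨u, v, huv⟩ := Nat.isCoprime_iff_coprime.mpr hmk
      rw [← one_zsmul a, ← huv, add_zsmul]
      refine add_mem (ihk (by omega) _ ?_) (ihm (by omega) _ ?_)
      · rw [← natCast_zsmul, smul_smul, show (k : ℤ) * (u * m) = u * (m * k) by ring,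
          mul_zsmul, hz, smul_zero]
      · rw [← natCast_zsmul, smul_smul, show (m : ℤ) * (v * k) = v * (m * k) by ring,
          mul_zsmul, hz, smul_zero]
  rw [eq_top_iff]
  intro a _
  exact key _ (hA a).addOrderOf_pos a (addOrderOf_nsmul_eq_zero a)

/-- Homomorphisms from a torsion abelian group agreeing on all primary components are equal. -/
theorem eq_of_eqOn_pComponent {A B : Type*} [AddCommGroup A] [AddCommGroup B]
    (hA : IsAddTorsion A) {f g : A →+ B}
    (h : ∀ p : ℕ, p.Prime → ∀ a ∈ pComponent A p, f a = g a) : f = g := by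
  have hle : ⨆ p : Nat.Primes, pComponent A p ≤ f.eqLocus g :=
    iSup_le fun p a ha => h p p.2 a ha
  rw [iSup_pComponent_eq_top hA] at hle
  ext a
  exact hle (AddSubgroup.mem_top a)

theorem exists_nsmul_ne_zero_of_mem_pComponent {A : Type*} [AddCommGroup A] {p : ℕ} {a : A}
    (ha : a ∈ pComponent A p) (h0 : a ≠ 0) : ∃ m : ℕ, m • a ≠ 0 ∧ p • m • a = 0 := by
  obtain ⟨n, hn⟩ := ha
  induction n with
  | zero => exact absurd (by simpa using hn) h0
  | succ n ih =>
    by_cases h : p ^ n • a = 0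
    · exact ih h
    · exact ⟨p ^ n, h, by rwa [smul_smul, ← pow_succ']⟩

theorem exists_zmod_hom_apply_one {A : Type*} [AddCommGroup A] {p : ℕ} {x : A} (hx : p • x = 0) :
    ∃ f : ZMod p →+ A, f 1 = x :=
  ⟨ZMod.lift p ⟨zmultiplesHom A x, by simpa using hx⟩, by
    simpa using ZMod.lift_coe p ⟨zmultiplesHom A x, by simpa using hx⟩ 1⟩

theorem zmod_hom_injective {A : Type*} [AddCommGroup A] {p : ℕ} [Fact p.Prime] (f : ZMod p →+ A)
    (hf : f 1 ≠ 0) : Function.Injective f := by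
  rw [injective_iff_map_eq_zero]
  intro z hz
  by_contra hne
  apply hf
  have h1 : (1 : ZMod p) = (z⁻¹).val • z := by
    rw [nsmul_eq_mul, ZMod.natCast_zmod_val, inv_mul_cancel₀ hne]
  rw [h1, map_nsmul, hz, smul_zero]

theorem exists_hom_zmod_apply_eq_one_of_nsmul_eq_zero {V : Type*} [AddCommGroup V] {p : ℕ}
    [Fact p.Prime] (hV : ∀ v : V, p • v = 0) {v : V} (hv : v ≠ 0) :
    ∃ f : V →+ ZMod p, f v = 1 := by
  have _ : Module (ZMod p) V := AddCommGroup.zmodModule hV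
  obtain ⟨f, hf⟩ := Module.Projective.exists_dual_eq_one (ZMod p) hv
  exact ⟨f.toAddMonoidHom, hf⟩

/-- An element not divisible by the prime `p` is detected by a homomorphism to `ZMod p`. -/
theorem exists_hom_zmod_apply_eq_one {A : Type*} [AddCommGroup A] {p : ℕ} [Fact p.Prime] {c : A}
    (hc : ∀ a : A, p • a ≠ c) : ∃ f : A →+ ZMod p, f c = 1 := by
  let H : AddSubgroup A := (nsmulAddMonoidHom (α := A) p).range
  have hne : (QuotientAddGroup.mk' H c) ≠ 0 := by
    intro h
    obtain ⟨a, ha⟩ := (QuotientAddGroup.eq_zero_iff c).mp h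
    exact hc a ha
  have hH : ∀ q : A ⧸ H, p • q = 0 := by
    intro q
    obtain ⟨a, rfl⟩ := QuotientAddGroup.mk'_surjective H q
    rw [← map_nsmul]
    exact (QuotientAddGroup.eq_zero_iff _).mpr ⟨a, rfl⟩
  obtain ⟨f, hf⟩ := exists_hom_zmod_apply_eq_one_of_nsmul_eq_zero hH hne
  exact ⟨f.comp (QuotientAddGroup.mk' H), hf⟩

/-- A `p`-primary abelian group that is divisible by the prime `p` is divisible. -/
theorem exists_nsmul_eq_of_primary {C : Type*} [AddCommGroup C] {p : ℕ} (hp : p.Prime)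
    (hC : ∀ c : C, c ∈ pComponent C p) (hdiv : ∀ c : C, ∃ d : C, p • d = c) {n : ℕ} (hn : n ≠ 0)
    (c : C) : ∃ d : C, n • d = c := by
  induction n using Nat.recOnMul generalizing c with
  | zero => exact absurd rfl hn
  | one => exact ⟨c, one_nsmul c⟩
  | prime q hq =>
    by_cases hqp : q = p
    · exact hqp ▸ hdiv c
    · obtain ⟨k, hk⟩ := hC c
      obtain ⟨u, v, huv⟩ := Nat.isCoprime_iff_coprime.mpr
        (((Nat.coprime_primes hq hp).mpr hqp).pow_right k)
      refine ⟨u • c, ?_⟩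
      have hz : ((p ^ k : ℕ) : ℤ) • c = 0 := by rw [natCast_zsmul, hk]
      calc q • u • c = (u * q + v * (p ^ k : ℕ)) • c := by
            rw [add_zsmul, mul_smul v, hz, smul_zero, add_zero, ← natCast_zsmul, smul_smul,
              mul_comm]
        _ = c := by rw [huv, one_zsmul]
  | mul a b iha ihb =>
    obtain ⟨d, hd⟩ := iha (left_ne_zero_of_mul hn) c
    obtain ⟨d', hd'⟩ := ihb (right_ne_zero_of_mul hn) d
    exact ⟨d', by rw [mul_smul, hd', hd]⟩

theorem baer_of_primary {C : Type*} [AddCommGroup C] {p : ℕ} (hp : p.Prime)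
    (hC : ∀ c : C, c ∈ pComponent C p) (hdiv : ∀ c : C, ∃ d : C, p • d = c) :
    Module.Baer ℤ C := by
  let : DivisibleBy C ℕ := divisibleByOfSMulRightSurj C ℕ fun {n} hn c =>
    exists_nsmul_eq_of_primary hp hC hdiv hn c
  let : DivisibleBy C ℤ := AddGroup.divisibleByIntOfDivisibleByNat C
  exact Module.Baer.of_divisible C

/-- On a primary component, a central idempotent endomorphism cannot have both a nonzero image
and a nonzero kernel. -/
theorem eq_zero_or_eq_zero_of_central_idempotent {A : Type*} [AddCommGroup A]
    {e : AddMonoid.End A} (he : ∀ a, e (e a) = e a)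
    (hcomm : ∀ (f : A →+ A) (a : A), e (f a) = f (e a)) {p : ℕ} (hp : p.Prime) {x y : A}
    (hx : x ∈ pComponent A p) (hy : y ∈ pComponent A p) (hex : e x = x) (hey : e y = 0) :
    x = 0 ∨ y = 0 := by
  have : Fact p.Prime := ⟨hp⟩
  by_contra! hne
  obtain ⟨m, hm, hpm⟩ := exists_nsmul_ne_zero_of_mem_pComponent hx hne.1
  obtain ⟨k, hk, hpk⟩ := exists_nsmul_ne_zero_of_mem_pComponent hy hne.2
  have hex' : e (m • x) = m • x := by rw [map_nsmul, hex]
  have hey' : e (k • y) = 0 := by rw [map_nsmul, hey, smul_zero]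
  obtain ⟨i, hi⟩ := exists_zmod_hom_apply_one hpm
  let C : AddSubgroup A := AddMonoidHom.ker e ⊓ pComponent A p
  by_cases hdiv : ∀ c : C, ∃ d : C, p • d = c
  · have hC : ∀ c : C, c ∈ pComponent C p := by
      rintro ⟨c, hc, n, hn⟩
      exact ⟨n, Subtype.ext hn⟩
    let z : C := ⟨k • y, hey', nsmul_mem hy k⟩
    have hz : p • z = 0 := Subtype.ext hpk
    obtain ⟨g, hg⟩ := exists_zmod_hom_apply_one hz
    obtain ⟨h, hh⟩ := (baer_of_primary hp hC hdiv).extension_property_addMonoidHom i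
      (zmod_hom_injective i (hi ▸ hm)) g
    have hhx : h (m • x) = z := by
      rw [← hi, ← hg, ← hh]
      rfl
    have hc := hcomm (C.subtype.comp h) (m • x)
    rw [hex', AddMonoidHom.comp_apply, hhx] at hc
    exact hk (hc.symm.trans hey')
  · push Not at hdiv
    obtain ⟨⟨c, hc, n, hn⟩, hcd⟩ := hdiv
    have hec : e c = 0 := hc
    have hcA : ∀ a : A, p • a ≠ c := by
      intro a ha
      have hpe : p • (a - e a) = c := by rw [smul_sub, ← map_nsmul, ha, hec, sub_zero]
      refine hcd ⟨a - e a, ?_, n + 1, ?_⟩ (Subtype.ext hpe)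
      · change e (a - e a) = 0
        rw [map_sub, he, sub_self]
      · rw [pow_succ, mul_smul, hpe, hn]
    obtain ⟨f, hf⟩ := exists_hom_zmod_apply_eq_one hcA
    have h := hcomm (i.comp f) c
    rw [hec, map_zero, AddMonoidHom.comp_apply, hf, hi, hex'] at h
    exact hm h

/-- For a periodic abelian group `A`, an endomorphism `e` of `A` is a
central idempotent of `End A` if and only if there is a set `M` of primes such that `e`
is the projection onto `⊕_{p ∈ M} A_p` along `⊕_{p ∉ M} A_p`, i.e. `e` restricts to the
identity on `A_p` for `p ∈ M` and to zero on `A_p` for primes `p ∉ M`. -/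
theorem centralIdempotent_iff_proj
    (A : Type*) [AddCommGroup A] (hA : AddMonoid.IsTorsion A) (e : AddMonoid.End A) :
    (e * e = e ∧ ∀ f : AddMonoid.End A, e * f = f * e) ↔
      ∃ M : Set ℕ, (∀ p ∈ M, p.Prime) ∧
        (∀ p ∈ M, ∀ a ∈ pComponent A p, e a = a) ∧
        (∀ p : ℕ, p.Prime → p ∉ M → ∀ a ∈ pComponent A p, e a = 0) := by
  constructor
  · rintro ⟨hidem, hcentral⟩
    have he : ∀ a, e (e a) = e a := fun a => DFunLike.congr_fun hidem a
    have hcomm : ∀ (f : A →+ A) (a : A), e (f a) = f (e a) :=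
      fun f a => DFunLike.congr_fun (hcentral f) a
    refine ⟨{p | p.Prime ∧ ∀ a ∈ pComponent A p, e a = a}, fun p hp => hp.1, fun p hp => hp.2, ?_⟩
    intro p hp hpM a ha
    have hb : ∃ b ∈ pComponent A p, e b ≠ b := by
      by_contra! h
      exact hpM ⟨hp, h⟩
    obtain ⟨b, hb, hne⟩ := hb
    have hy : e (b - e b) = 0 := by rw [map_sub, he, sub_self]
    exact (eq_zero_or_eq_zero_of_central_idempotent he hcomm hp (map_mem_pComponent e ha)
      (sub_mem hb (map_mem_pComponent e hb)) (he a) hy).resolve_right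
      fun h => hne (sub_eq_zero.mp h).symm
  · rintro ⟨M, -, hM, hM'⟩
    refine ⟨eq_of_eqOn_pComponent hA fun p hp a ha => ?_,
      fun f => eq_of_eqOn_pComponent hA fun p hp a ha => ?_⟩
    · change e (e a) = e a
      by_cases hpM : p ∈ M
      · rw [hM p hpM a ha, hM p hpM a ha]
      · rw [hM' p hp hpM a ha, map_zero]
    · change e (f a) = f (e a)
      have hfa := map_mem_pComponent f ha
      by_cases hpM : p ∈ M
      · exact (hM p hpM _ hfa).trans (congrArg f (hM p hpM a ha).symm)
      · rw [hM' p hp hpM a ha, map_zero]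
        exact hM' p hp hpM _ hfa
end

section
/- (Charles, Kaplansky) Let p be a prime and A a nonzero abelian p-group. If A is unbounded (there is no n with p^n·A = 0), then the center of the endomorphism ring End A is isomorphic as a ring to the ring ℤ_p of p-adic integers. If A is bounded and p^k is the least upper bound for the orders of its elements (p^k·A = 0 but p^{k-1}·A ≠ 0), then the center of End A is isomorphic as a ring to ℤ/p^kℤ. -/
theorem exists_linearMap_span_singleton_apply_eq {G A : Type*} [AddCommGroup G] [AddCommGroup A]
    (g : G) (a : A) (h : addOrderOf g • a = 0) :
    ∃ f : Submodule.span ℤ {g} →ₗ[ℤ] A, f ⟨g, Submodule.mem_span_singleton_self g⟩ = a := by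
  have H : ∀ c : ℤ, c • g = 0 → c • a = 0 := by
    intro c hc
    obtain ⟨d, rfl⟩ := addOrderOf_dvd_iff_zsmul_eq_zero.2 hc
    rw [mul_comm, mul_smul, natCast_zsmul, h, smul_zero]
  exact ⟨(LinearPMap.mkSpanSingleton' g a H).toFun, LinearPMap.mkSpanSingleton'_apply_self g a H _⟩

theorem Module.Baer.exists_addMonoidHom_apply_eq {G B : Type*} [AddCommGroup G] [AddCommGroup B]
    (hB : Module.Baer ℤ B) (g : G) (b : B) (h : addOrderOf g • b = 0) :
    ∃ f : G →+ B, f g = b := by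
  obtain ⟨f, hf⟩ := exists_linearMap_span_singleton_apply_eq g b h
  obtain ⟨F, hF⟩ := hB.extension_property (Submodule.span ℤ {g}).subtype
    Subtype.val_injective f
  refine ⟨F.toAddMonoidHom, ?_⟩
  rw [← hf, ← hF]
  rfl

theorem AddCircle.mem_zmultiples_of_addOrderOf_eq {N : ℕ} (hN : 0 < N) {u t : AddCircle (1 : ℚ)}
    (hu : addOrderOf u = N) (ht : N • t = 0) : t ∈ AddSubgroup.zmultiples u := by
  have : Fact ((0 : ℚ) < 1) := ⟨one_pos⟩
  obtain ⟨k, -, hk, rfl⟩ := (AddCircle.addOrderOf_eq_pos_iff hN).1 hu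
  obtain ⟨l, -, rfl⟩ := (AddCircle.nsmul_eq_zero_iff hN).1 ht
  simp only [AddCircle.natCast_div_mul_eq_nsmul] at *
  set e : AddCircle (1 : ℚ) := ((1 / N : ℚ) : AddCircle (1 : ℚ))
  have heN : N • e = 0 := by
    rw [← AddCircle.addOrderOf_period_div (p := (1 : ℚ)) hN, addOrderOf_nsmul_eq_zero]
  have hb := Nat.gcd_eq_gcd_ab k N
  rw [hk] at hb
  have hek : e = (k.gcdA N) • (k • e) := by
    have : ((1 : ℕ) : ℤ) • e = (k.gcdA N) • (k • e) := by
      rw [hb, add_smul, mul_comm, mul_smul, natCast_zsmul, mul_comm, mul_smul, natCast_zsmul, heN,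
        smul_zero, add_zero]
    simpa using this
  have hmem : e ∈ AddSubgroup.zmultiples (k • e) := ⟨_, hek.symm⟩
  exact nsmul_mem hmem l

section PrimaryGroup

variable {p : ℕ} [hp : Fact p.Prime] {A : Type*} [AddCommGroup A]

/-- If `p ^ n • y` has height exactly `n`, then `y` can be sent to any element `a` killed by
`p ^ (n + 1)` by an endomorphism whose image is generated by `a`. -/
theorem exists_end_apply_eq_of_height {n : ℕ} {y : A}
    (hny : ∀ a : A, p ^ (n + 1) • a ≠ p ^ n • y) {a : A} (ha : p ^ (n + 1) • a = 0) :
    ∃ f : A →+ A, f y = a ∧ ∀ b, ∃ c : ℤ, f b = c • a := by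
  let R : AddSubgroup A := (nsmulAddMonoidHom (α := A) (p ^ (n + 1))).range
  have hx : (QuotientAddGroup.mk (p ^ n • y) : A ⧸ R) ≠ 0 := by
    rw [Ne, QuotientAddGroup.eq_zero_iff]
    rintro ⟨b, hb⟩
    exact hny b hb
  obtain ⟨c, hc⟩ := CharacterModule.exists_character_apply_ne_zero_of_ne_zero hx
  let χ : A →+ AddCircle (1 : ℚ) := AddMonoidHom.comp c (QuotientAddGroup.mk' R)
  have hχ : ∀ b, p ^ (n + 1) • χ b = 0 := by
    intro b
    have : (QuotientAddGroup.mk (p ^ (n + 1) • b) : A ⧸ R) = 0 :=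
      (QuotientAddGroup.eq_zero_iff _).2 ⟨b, rfl⟩
    rw [← map_nsmul]
    change c (QuotientAddGroup.mk (p ^ (n + 1) • b) : A ⧸ R) = 0
    rw [this, map_zero]
  have hord : addOrderOf (χ y) = p ^ (n + 1) := by
    refine addOrderOf_eq_prime_pow ?_ (hχ y)
    rw [← map_nsmul]
    exact hc
  have hmem : ∀ b, χ.toIntLinearMap b ∈ Submodule.span ℤ {χ y} := by
    intro b
    rw [Submodule.mem_span_singleton]
    exact AddCircle.mem_zmultiples_of_addOrderOf_eq (pow_pos hp.out.pos _) hord (hχ b)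
  obtain ⟨f, hf⟩ := exists_linearMap_span_singleton_apply_eq (χ y) a (by rw [hord, ha])
  refine ⟨(f.comp (χ.toIntLinearMap.codRestrict _ hmem)).toAddMonoidHom, hf, fun b => ?_⟩
  obtain ⟨c, hc⟩ := Submodule.mem_span_singleton.1 (hmem b)
  refine ⟨c, ?_⟩
  rw [← hf, ← map_zsmul]
  exact congrArg f (Subtype.ext hc.symm)

theorem exists_smul_eq_of_height {n : ℕ} {y : A} (hy : p ^ (n + 1) • y = 0)
    (hny : ∀ a : A, p ^ (n + 1) • a ≠ p ^ n • y) {φ : A →+ A}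
    (hφ : ∀ (f : A →+ A) (a : A), φ (f a) = f (φ a)) :
    ∃ c : ℤ, ∀ a : A, p ^ (n + 1) • a = 0 → φ a = c • a := by
  obtain ⟨π, hπ, hπ'⟩ := exists_end_apply_eq_of_height hny hy
  obtain ⟨c, hc⟩ := hπ' (φ y)
  rw [← hφ, hπ] at hc
  refine ⟨c, fun a ha => ?_⟩
  obtain ⟨f, hf, -⟩ := exists_end_apply_eq_of_height hny ha
  rw [← hf, hφ, hc, map_zsmul]

/-- If no socle element has finite height at least `m`, then `p ^ m • A` is divisible. -/
theorem baer_range_nsmul_of_height (hpgrp : ∀ a : A, ∃ n : ℕ, p ^ n • a = 0) {m : ℕ}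
    (h : ∀ n, m ≤ n → ∀ y : A, p ^ (n + 1) • y = 0 → ∃ a : A, p ^ (n + 1) • a = p ^ n • y) :
    Module.Baer ℤ (nsmulAddMonoidHom (α := A) (p ^ m)).range := by
  have key : ∀ k (a : A), p ^ k • p ^ m • a = 0 → ∃ a' : A, p • p ^ m • a' = p ^ m • a := by
    intro k
    induction k with
    | zero => intro a ha; exact ⟨0, by simpa using ha.symm⟩
    | succ k ih =>
      intro a ha
      obtain ⟨b, hb⟩ := h (m + k) (by omega) a (by rw [← ha, smul_smul]; congr 1; ring)
      obtain ⟨a', ha'⟩ := ih (a - p • b) (by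
        simp only [smul_sub, smul_smul]
        rw [sub_eq_zero, show p ^ k * p ^ m = p ^ (m + k) by ring, ← hb]
        congr 1; ring)
      refine ⟨a' + b, ?_⟩
      rw [smul_add, smul_add, ha', smul_sub, smul_comm p, sub_add_cancel]
  set B := (nsmulAddMonoidHom (α := A) (p ^ m)).range
  have hsurj : ∀ n : ℕ, n ≠ 0 → ∀ b : B, ∃ b' : B, n • b' = b := by
    intro n
    induction n using induction_on_primes with
    | zero => intro h; exact absurd rfl h
    | one => intro _ b; exact ⟨b, one_smul _ b⟩
    | prime_mul q n hq ih =>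
      intro h0 b
      have hq' : ∃ b' : B, q • b' = b := by
        obtain ⟨b, a, rfl⟩ := b
        obtain ⟨k, hk⟩ := hpgrp (p ^ m • a)
        by_cases hqp : q = p
        · subst hqp
          obtain ⟨a', ha'⟩ := key k a hk
          exact ⟨⟨_, a', rfl⟩, Subtype.ext ha'⟩
        · have hco : q.Coprime (p ^ k) := Nat.Coprime.pow_right _
            ((Nat.coprime_primes hq hp.out).2 hqp)
          have hb := Nat.gcd_eq_gcd_ab q (p ^ k)
          rw [hco] at hb
          refine ⟨(q.gcdA (p ^ k)) • ⟨_, a, rfl⟩, Subtype.ext ?_⟩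
          change q • (q.gcdA (p ^ k)) • p ^ m • a = p ^ m • a
          have h1 : ((1 : ℕ) : ℤ) • p ^ m • a = q • (q.gcdA (p ^ k)) • p ^ m • a := by
            rw [hb, add_smul, mul_smul, natCast_zsmul, mul_comm, mul_smul _ _ (p ^ m • a),
              natCast_zsmul (p ^ m • a) (p ^ k), hk, smul_zero, add_zero]
          simpa using h1.symm
      obtain ⟨b', hb'⟩ := hq'
      obtain ⟨b'', hb''⟩ := ih (right_ne_zero_of_mul h0) b'
      exact ⟨b'', by rw [mul_smul, hb'', hb']⟩
  have : DivisibleBy B ℕ := divisibleByOfSMulRightSurj B ℕ fun {n} hn b => hsurj n hn b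
  have : DivisibleBy B ℤ := AddGroup.divisibleByIntOfDivisibleByNat B
  exact Module.Baer.of_divisible B

theorem exists_addOrderOf_pow_smul_eq_of_pow_smul_ne_zero (hpgrp : ∀ a : A, ∃ n : ℕ, p ^ n • a = 0)
    {m : ℕ} {b : A} (hb : p ^ m • b ≠ 0) :
    ∃ j : ℕ, addOrderOf (p ^ j • b) = p ^ m := by
  obtain ⟨k, hk⟩ := exists_addOrderOf_eq_prime_pow_iff.2 (hpgrp b)
  have hmk : m ≤ k := by
    by_contra! h
    exact hb (addOrderOf_dvd_iff_nsmul_eq_zero.1 (hk ▸ pow_dvd_pow p h.le))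
  refine ⟨k - m, ?_⟩
  rw [addOrderOf_nsmul_of_dvd (pow_pos hp.out.pos _).ne', hk, Nat.pow_div (by omega) hp.out.pos]
  · congr 1; omega
  · rw [hk]; exact pow_dvd_pow p (by omega)

/-- Endomorphisms commuting with all maps into an injective subgroup `B` of unbounded exponent
act locally as integers. -/
theorem exists_smul_eq_of_baer (hpgrp : ∀ a : A, ∃ n : ℕ, p ^ n • a = 0) {B : AddSubgroup A}
    (hB : Module.Baer ℤ B) (hBunb : ∀ n : ℕ, ∃ b : B, p ^ n • b ≠ 0) {φ : A →+ A}
    (hφ : ∀ (f : A →+ A) (a : A), φ (f a) = f (φ a)) (m : ℕ) :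
    ∃ c : ℤ, ∀ a : A, p ^ m • a = 0 → φ a = c • a := by
  have hBp : ∀ b : B, ∃ n : ℕ, p ^ n • b = 0 := fun b =>
    (hpgrp b).imp fun n hn => Subtype.ext hn
  have hord : ∀ n : ℕ, ∃ b : B, addOrderOf b = p ^ n := by
    intro n
    obtain ⟨b, hb⟩ := hBunb n
    obtain ⟨j, hj⟩ := exists_addOrderOf_pow_smul_eq_of_pow_smul_ne_zero hBp hb
    exact ⟨_, hj⟩
  have hloc : ∀ a : A, ∃ c : ℤ, φ a = c • a := by
    intro a
    by_contra hcon
    have hq : (QuotientAddGroup.mk (φ a) : A ⧸ AddSubgroup.zmultiples a) ≠ 0 := by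
      rw [Ne, QuotientAddGroup.eq_zero_iff]
      rintro ⟨c, hc⟩
      exact hcon ⟨c, hc.symm⟩
    obtain ⟨n, hn⟩ := hpgrp (φ a)
    obtain ⟨k, hk⟩ := exists_addOrderOf_eq_prime_pow_iff.2
      ⟨n, show p ^ n • (QuotientAddGroup.mk (φ a) : A ⧸ AddSubgroup.zmultiples a) = 0 by
        rw [← QuotientAddGroup.mk_nsmul, hn, QuotientAddGroup.mk_zero]⟩
    obtain ⟨b, hb⟩ := hord k
    obtain ⟨f, hf⟩ := hB.exists_addMonoidHom_apply_eq
      (QuotientAddGroup.mk (φ a) : A ⧸ AddSubgroup.zmultiples a) b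
      (by rw [hk, ← hb, addOrderOf_nsmul_eq_zero])
    have h1 := hφ (B.subtype.comp (f.comp (QuotientAddGroup.mk' _))) a
    have h2 : (QuotientAddGroup.mk a : A ⧸ AddSubgroup.zmultiples a) = 0 :=
      (QuotientAddGroup.eq_zero_iff _).2 (AddSubgroup.mem_zmultiples a)
    simp only [AddMonoidHom.comp_apply, QuotientAddGroup.mk'_apply, hf, h2, map_zero] at h1
    have hb0 : b = 0 := Subtype.ext h1.symm
    rw [hb0, addOrderOf_zero] at hb
    rw [← hb] at hk
    exact hq (AddMonoid.addOrderOf_eq_one_iff.1 hk)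
  obtain ⟨d, hd⟩ := hord m
  obtain ⟨c, hc⟩ := hloc d
  refine ⟨c, fun a ha => ?_⟩
  obtain ⟨c', hc'⟩ := hloc a
  obtain ⟨k, hk⟩ := exists_addOrderOf_eq_prime_pow_iff.2 ⟨m, ha⟩
  have hkm : k ≤ m := (Nat.pow_dvd_pow_iff_le_right hp.out.one_lt).1
    (hk ▸ addOrderOf_dvd_of_nsmul_eq_zero ha)
  have hd' : addOrderOf (p ^ (m - k) • d) = p ^ k := by
    rw [addOrderOf_nsmul_of_dvd (pow_pos hp.out.pos _).ne', hd,
      Nat.pow_div (Nat.sub_le _ _) hp.out.pos]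
    · congr 1; omega
    · rw [hd]; exact pow_dvd_pow p (Nat.sub_le _ _)
  obtain ⟨f, hf⟩ := hB.exists_addMonoidHom_apply_eq a (p ^ (m - k) • d)
    (by rw [hk, ← hd', addOrderOf_nsmul_eq_zero])
  have h1 := hφ (B.subtype.comp f) a
  simp only [AddMonoidHom.comp_apply, hc', map_zsmul, hf, map_nsmul,
    AddSubgroup.subtype_apply, hc] at h1
  have h2 : (c - c') • (p ^ (m - k) • d) = 0 := by
    apply Subtype.ext
    rw [sub_smul, AddSubgroup.coe_sub, ZeroMemClass.coe_zero, sub_eq_zero]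
    simp only [AddSubgroup.coe_zsmul, AddSubgroup.coe_nsmul]
    rw [← h1, smul_comm]
  rw [← addOrderOf_dvd_iff_zsmul_eq_zero, hd', ← hk, addOrderOf_dvd_iff_zsmul_eq_zero,
    sub_smul, sub_eq_zero] at h2
  rw [hc', h2]

theorem exists_smul_eq_of_unbounded (hpgrp : ∀ a : A, ∃ n : ℕ, p ^ n • a = 0)
    (hunb : ¬ ∃ n : ℕ, ∀ a : A, p ^ n • a = 0) {φ : A →+ A}
    (hφ : ∀ (f : A →+ A) (a : A), φ (f a) = f (φ a)) (m : ℕ) :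
    ∃ c : ℤ, ∀ a : A, p ^ m • a = 0 → φ a = c • a := by
  by_cases h : ∀ n, m ≤ n → ∀ y : A, p ^ (n + 1) • y = 0 →
      ∃ a : A, p ^ (n + 1) • a = p ^ n • y
  · refine exists_smul_eq_of_baer hpgrp (baer_range_nsmul_of_height hpgrp h) (fun n => ?_) hφ m
    by_contra! hcon
    refine hunb ⟨n + m, fun a => ?_⟩
    have := congrArg Subtype.val (hcon ⟨_, a, rfl⟩)
    rw [pow_add, mul_smul]
    exact this
  · push Not at h
    obtain ⟨n, hmn, y, hy, hny⟩ := h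
    obtain ⟨c, hc⟩ := exists_smul_eq_of_height hy hny hφ
    refine ⟨c, fun a ha => hc a ?_⟩
    obtain ⟨j, rfl⟩ := Nat.exists_eq_add_of_le hmn
    rw [show m + j + 1 = (j + 1) + m by ring, pow_add, mul_smul, ha, smul_zero]

theorem center_apply_comm (φ : Subring.center (AddMonoid.End A)) (f : A →+ A) (a : A) :
    φ.1 (f a) = f (φ.1 a) :=
  (DFunLike.congr_fun (Subring.mem_center_iff.1 φ.2 f) a).symm

theorem zsmul_eq_zsmul_iff_intCast_eq {n : ℕ} {e : A} (he : addOrderOf e = n) {c d : ℤ} :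
    c • e = d • e ↔ (c : ZMod n) = d := by
  rw [← sub_eq_zero, ← sub_smul, ← addOrderOf_dvd_iff_zsmul_eq_zero, he,
    ← ZMod.intCast_zmod_eq_zero_iff_dvd, Int.cast_sub, sub_eq_zero]

theorem nonempty_center_end_ringEquiv_zmod {n : ℕ} {e : A} (he : addOrderOf e = n)
    (hn : ∀ a : A, n • a = 0)
    (hloc : ∀ φ : Subring.center (AddMonoid.End A), ∃ c : ℤ, ∀ a : A, φ.1 a = c • a) :
    Nonempty (Subring.center (AddMonoid.End A) ≃+* ZMod n) := by
  have hchar : CharP (Subring.center (AddMonoid.End A)) n := by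
    refine ⟨fun x => ⟨fun hx => ?_, ?_⟩⟩
    · rw [← he, addOrderOf_dvd_iff_nsmul_eq_zero]
      exact DFunLike.congr_fun (congrArg Subtype.val hx) e
    · rintro ⟨d, rfl⟩
      refine Subtype.ext (AddMonoidHom.ext fun a => ?_)
      change (n * d) • a = 0
      rw [mul_comm, mul_smul, hn, smul_zero]
  refine ⟨(RingEquiv.ofBijective (ZMod.castHom (dvd_refl n) (Subring.center (AddMonoid.End A)))
    ⟨ZMod.castHom_injective _, fun φ => ?_⟩).symm⟩
  obtain ⟨c, hc⟩ := hloc φ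
  refine ⟨c, ?_⟩
  rw [map_intCast]
  refine Subtype.ext (AddMonoidHom.ext fun a => ?_)
  exact (hc a).symm

theorem exists_center_end_ringHom_zmod {n : ℕ} {e : A} (he : addOrderOf e = n)
    (hloc : ∀ φ : Subring.center (AddMonoid.End A),
      ∃ c : ℤ, ∀ a : A, n • a = 0 → φ.1 a = c • a) :
    ∃ F : Subring.center (AddMonoid.End A) →+* ZMod n, ∀ φ (c : ℤ),
      F φ = c ↔ ∀ a : A, n • a = 0 → φ.1 a = c • a := by
  choose C hC using hloc
  have hne : n • e = 0 := he ▸ addOrderOf_nsmul_eq_zero e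
  have huniq : ∀ φ (c : ℤ), φ.1 e = c • e → (C φ : ZMod n) = c := fun φ c h => by
    rw [← zsmul_eq_zsmul_iff_intCast_eq he, ← hC φ e hne, h]
  refine ⟨{ toFun := fun φ => C φ, map_one' := ?_, map_mul' := ?_, map_zero' := ?_,
            map_add' := ?_ }, fun φ c => ⟨fun h a ha => ?_, fun h => huniq φ c (h e hne)⟩⟩
  · exact (huniq 1 1 (one_smul ℤ e).symm).trans Int.cast_one
  · intro φ ψ
    rw [← Int.cast_mul]
    refine huniq _ _ ?_
    change φ.1 (ψ.1 e) = _
    rw [hC ψ e hne, map_zsmul, hC φ e hne, smul_smul, mul_comm]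
  · exact (huniq 0 0 (zero_smul ℤ e).symm).trans Int.cast_zero
  · intro φ ψ
    rw [← Int.cast_add]
    refine huniq _ _ ?_
    change φ.1 e + ψ.1 e = _
    rw [hC ψ e hne, hC φ e hne, add_smul]
  · change (C φ : ZMod n) = c at h
    rw [← sub_eq_zero, ← Int.cast_sub, ZMod.intCast_zmod_eq_zero_iff_dvd] at h
    obtain ⟨d, hd⟩ := h
    rw [hC φ a ha, ← sub_eq_zero, ← sub_smul, hd, mul_comm, mul_smul, natCast_zsmul, ha, smul_zero]

theorem PadicInt.toZModPow_val_smul_eq (z : ℤ_[p]) {n m : ℕ} {a : A} (hn : p ^ n • a = 0)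
    (hm : p ^ m • a = 0) : (toZModPow n z).val • a = (toZModPow m z).val • a := by
  wlog h : n ≤ m generalizing n m
  · exact (this hm hn (by omega)).symm
  have hc := PadicInt.cast_toZModPow n m h z
  rw [← hc, ← ZMod.natCast_val, ZMod.val_natCast]
  conv_rhs => rw [← Nat.mod_add_div (toZModPow m z).val (p ^ n)]
  rw [add_smul, mul_comm, mul_smul, hn, smul_zero, add_zero]

/-- Every `p`-adic integer acts on a `p`-primary group by a central endomorphism. -/
theorem PadicInt.exists_center_end_apply_eq (hpgrp : ∀ a : A, ∃ n : ℕ, p ^ n • a = 0)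
    (z : ℤ_[p]) : ∃ φ : Subring.center (AddMonoid.End A), ∀ (n : ℕ) (a : A), p ^ n • a = 0 →
      φ.1 a = (toZModPow n z).val • a := by
  choose N hN using hpgrp
  have key : ∀ (n : ℕ) (a : A), p ^ n • a = 0 →
      (toZModPow (N a) z).val • a = (toZModPow n z).val • a := fun n a ha =>
    toZModPow_val_smul_eq z (hN a) ha
  have hle : ∀ {n m : ℕ} {a : A}, n ≤ m → p ^ n • a = 0 → p ^ m • a = 0 := by
    intro n m a h ha
    rw [← Nat.sub_add_cancel h, pow_add, mul_smul, ha, smul_zero]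
  let φ : A →+ A := AddMonoidHom.mk' (fun a => (toZModPow (N a) z).val • a) (by
    intro a b
    have ha := hle (le_max_left (N a) (N b)) (hN a)
    have hb := hle (le_max_right (N a) (N b)) (hN b)
    rw [key _ a ha, key _ b hb, key _ (a + b) (by rw [smul_add, ha, hb, add_zero]), smul_add])
  refine ⟨⟨φ, Subring.mem_center_iff.2 fun f => AddMonoidHom.ext fun a => ?_⟩, key⟩
  change f ((toZModPow (N a) z).val • a) = (toZModPow (N (f a)) z).val • f a
  rw [key (N a) (f a) (by rw [← map_nsmul, hN, map_zero]), map_nsmul]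

end PrimaryGroup


/-- **Charles, Kaplansky.** Let `A` be a nonzero abelian `p`-group.
If `A` is unbounded, the center of `End A` is isomorphic as a ring to the `p`-adic
integers `ℤ_p`; if `A` is bounded with least bound `p^k`, the center of `End A` is
isomorphic to `ℤ/p^kℤ`. -/
theorem center_end_of_pGroup
    (p : ℕ) [Fact p.Prime] (A : Type*) [AddCommGroup A]
    (hnz : ∃ a : A, a ≠ 0)
    (hpgrp : ∀ a : A, ∃ n : ℕ, p ^ n • a = 0) :
    ((¬ ∃ n : ℕ, ∀ a : A, p ^ n • a = 0) →
      Nonempty (Subring.center (AddMonoid.End A) ≃+* PadicInt p)) ∧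
    (∀ k : ℕ, (∀ a : A, p ^ k • a = 0) → (¬ ∀ a : A, p ^ (k - 1) • a = 0) →
      Nonempty (Subring.center (AddMonoid.End A) ≃+* ZMod (p ^ k))) := by
  constructor
  · intro hunb
    have hord : ∀ n : ℕ, ∃ e : A, addOrderOf e = p ^ n := by
      intro n
      push Not at hunb
      obtain ⟨b, hb⟩ := hunb n
      obtain ⟨j, hj⟩ := exists_addOrderOf_pow_smul_eq_of_pow_smul_ne_zero hpgrp hb
      exact ⟨_, hj⟩
    have hloc : ∀ (n : ℕ) (φ : Subring.center (AddMonoid.End A)),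
        ∃ c : ℤ, ∀ a : A, p ^ n • a = 0 → φ.1 a = c • a := fun n φ =>
      exists_smul_eq_of_unbounded hpgrp hunb (center_apply_comm φ) n
    have hF := fun n => exists_center_end_ringHom_zmod (hord n).choose_spec (hloc n)
    choose F hF using hF
    have hcompat : ∀ (k1 k2) (hk : k1 ≤ k2),
        (ZMod.castHom (pow_dvd_pow p hk) _).comp (F k2) = F k1 := by
      intro k1 k2 hk
      ext φ
      obtain ⟨c, hc⟩ := hloc k2 φ
      rw [RingHom.comp_apply, (hF k2 φ c).2 hc, map_intCast, eq_comm, hF k1 φ c]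
      intro a ha
      refine hc a ?_
      rw [← Nat.sub_add_cancel hk, pow_add, mul_smul, ha, smul_zero]
    have hspec : ∀ n φ, PadicInt.toZModPow n (PadicInt.lift hcompat φ) = F n φ := fun n φ =>
      DFunLike.congr_fun (PadicInt.lift_spec hcompat n) φ
    refine ⟨RingEquiv.ofBijective (PadicInt.lift hcompat) ⟨?_, fun z => ?_⟩⟩
    · rw [injective_iff_map_eq_zero]
      intro φ hφ
      refine Subtype.ext (AddMonoidHom.ext fun a => ?_)
      obtain ⟨n, hn⟩ := hpgrp a
      have h0 : F n φ = ((0 : ℤ) : ZMod (p ^ n)) := by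
        rw [← hspec, hφ, map_zero, Int.cast_zero]
      exact ((hF n φ 0).1 h0 a hn).trans (zero_smul ℤ a)
    · obtain ⟨φ, hφ⟩ := PadicInt.exists_center_end_apply_eq hpgrp z
      refine ⟨φ, PadicInt.ext_of_toZModPow.1 fun n => ?_⟩
      rw [hspec, (hF n φ (PadicInt.toZModPow n z).val).2 fun a ha => by
        rw [hφ n a ha, natCast_zsmul], Int.cast_natCast, ZMod.natCast_zmod_val]
  · intro k hk hk'
    push Not at hk'
    obtain ⟨y, hy⟩ := hk'
    obtain _ | n := k
    · exact absurd (hk y) hy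
    · refine nonempty_center_end_ringEquiv_zmod (addOrderOf_eq_prime_pow hy (hk y)) hk fun φ => ?_
      obtain ⟨c, hc⟩ := exists_smul_eq_of_height (hk y) (fun a => by rw [hk a]; exact hy.symm)
        (center_apply_comm φ)
      exact ⟨c, fun a => hc a (hk a)⟩
end
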